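/- Suppose additionally that c ∈ (0,1), μ and h are even, h is decreasing on (0,c], and both μ(t) and t^{μ(t)}h(t) are increasing on (0,c]. Then for every x > 0 and r > 0 with x² + r² < c², one has |ω(x,r) − μ(0)| ≥ (μ(x/2) − μ(0))/3, where ω(x,r) = k₁(x,r)/k₂(x,r) with β(t) = μ(t)|t|^{μ(t)}h(t), ν(t) = μ(t) + 2, k₁(x,r) = ∫_{−c}^{c} μ(t)β(t)/[(t−x)² + r²]^{ν(t)/2} dt, and k₂(x,r) = ∫_{−c}^{c} β(t)/[(t−x)² + r²]^{ν(t)/2} dt. -/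

import Mathlib

open MeasureTheory Set Filter

/-- If `w` is nonnegative on `[x/2, c]` and `[-c, -x/2]`, and on `(0, x/2)` both `w (-t) ≤ w t` and
`w t ≤ w (x - t)`, then a nonnegative `m` that is at least `d` off `(-x/2, x/2)` has `w`-average at
least `d / 3`. -/
theorem third_mul_integral_le_of_reflection {c x d : ℝ} {w m : ℝ → ℝ}
    (hx : 0 < x) (hxc : x < c) (hd : 0 ≤ d)
    (hw : IntervalIntegrable w volume (-c) c)
    (hmw : IntervalIntegrable (fun t => m t * w t) volume (-c) c)
    (hwpos : ∀ t ∈ Icc (-c) c, t ≠ 0 → 0 < w t)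
    (hmid : ∀ t ∈ Icc (-(x / 2)) (x / 2), 0 ≤ m t * w t)
    (hmleft : ∀ t ∈ Icc (-c) (-(x / 2)), d ≤ m t)
    (hmright : ∀ t ∈ Icc (x / 2) c, d ≤ m t)
    (hneg : ∀ t ∈ Ioo 0 (x / 2), w (-t) ≤ w t)
    (hrefl : ∀ t ∈ Ioo 0 (x / 2), w t ≤ w (x - t)) :
    0 < ∫ t in (-c)..c, w t ∧
      d / 3 * ∫ t in (-c)..c, w t ≤ ∫ t in (-c)..c, m t * w t := by
  have sub : ∀ {f : ℝ → ℝ}, IntervalIntegrable f volume (-c) c → ∀ {a b : ℝ}, -c ≤ a → a ≤ c →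
      -c ≤ b → b ≤ c → IntervalIntegrable f volume a b := by
    intro f hf a b h1 h2 h3 h4
    refine hf.mono_set ?_
    rw [uIcc_of_le (by linarith : -c ≤ c)]
    exact uIcc_subset_Icc ⟨h1, h2⟩ ⟨h3, h4⟩
  have wA := sub hw (a := -c) (b := -(x / 2)) (by linarith) (by linarith) (by linarith)
    (by linarith)
  have wB := sub hw (a := -(x / 2)) (b := 0) (by linarith) (by linarith) (by linarith)
    (by linarith)
  have wC := sub hw (a := 0) (b := x / 2) (by linarith) (by linarith) (by linarith) (by linarith)
  have wD := sub hw (a := x / 2) (b := x) (by linarith) (by linarith) (by linarith) (by linarith)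
  have wE := sub hw (a := x) (b := c) (by linarith) (by linarith) (by linarith) (by linarith)
  have mA := sub hmw (a := -c) (b := -(x / 2)) (by linarith) (by linarith) (by linarith)
    (by linarith)
  have mM := sub hmw (a := -(x / 2)) (b := x / 2) (by linarith) (by linarith) (by linarith)
    (by linarith)
  have mR := sub hmw (a := x / 2) (b := c) (by linarith) (by linarith) (by linarith) (by linarith)
  have wsplit := intervalIntegral.integral_add_adjacent_intervals
    (((wA.trans wB).trans wC).trans wD) wE
  rw [← intervalIntegral.integral_add_adjacent_intervals ((wA.trans wB).trans wC) wD,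
    ← intervalIntegral.integral_add_adjacent_intervals (wA.trans wB) wC,
    ← intervalIntegral.integral_add_adjacent_intervals wA wB] at wsplit
  have msplit := intervalIntegral.integral_add_adjacent_intervals (mA.trans mM) mR
  rw [← intervalIntegral.integral_add_adjacent_intervals mA mM] at msplit
  have rsplit := intervalIntegral.integral_add_adjacent_intervals wD wE
  have hposA : 0 < ∫ t in (-c)..(-(x / 2)), w t :=
    intervalIntegral.intervalIntegral_pos_of_pos_on wA
      (fun t ht => hwpos t ⟨ht.1.le, by linarith [ht.2]⟩ (by linarith [ht.2])) (by linarith)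
  have hposB : 0 < ∫ t in (-(x / 2))..0, w t :=
    intervalIntegral.intervalIntegral_pos_of_pos_on wB
      (fun t ht => hwpos t ⟨by linarith [ht.1], by linarith [ht.2]⟩ ht.2.ne) (by linarith)
  have hposC : 0 < ∫ t in (0)..(x / 2), w t :=
    intervalIntegral.intervalIntegral_pos_of_pos_on wC
      (fun t ht => hwpos t ⟨by linarith [ht.1], by linarith [ht.2]⟩ ht.1.ne') (by linarith)
  have hposD : 0 < ∫ t in (x / 2)..x, w t :=
    intervalIntegral.intervalIntegral_pos_of_pos_on wD
      (fun t ht => hwpos t ⟨by linarith [ht.1], by linarith [ht.2]⟩ (by linarith [ht.1]))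
      (by linarith)
  have hposE : 0 < ∫ t in x..c, w t :=
    intervalIntegral.intervalIntegral_pos_of_pos_on wE
      (fun t ht => hwpos t ⟨by linarith [ht.1], by linarith [ht.2]⟩ (by linarith [ht.1]))
      (by linarith)
  have hBC : ∫ t in (-(x / 2))..0, w t ≤ ∫ t in (0)..(x / 2), w t := by
    have e := intervalIntegral.integral_comp_neg (a := 0) (b := x / 2) w
    rw [neg_zero] at e
    rw [← e]
    refine intervalIntegral.integral_mono_on_of_le_Ioo (by linarith) ?_ wC hneg
    simpa using ((IntervalIntegrable.iff_comp_neg (f := w) (a := -(x / 2)) (b := 0)).1 wB).symm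
  have hCD : ∫ t in (0)..(x / 2), w t ≤ ∫ t in (x / 2)..x, w t := by
    have e := intervalIntegral.integral_comp_sub_left (a := 0) (b := x / 2) w x
    rw [sub_zero, sub_half] at e
    rw [← e]
    refine intervalIntegral.integral_mono_on_of_le_Ioo (by linarith) wC ?_ hrefl
    simpa [sub_half] using (wD.comp_sub_left x).symm
  have hmA : d * ∫ t in (-c)..(-(x / 2)), w t ≤ ∫ t in (-c)..(-(x / 2)), m t * w t := by
    rw [← intervalIntegral.integral_const_mul]
    exact intervalIntegral.integral_mono_on (by linarith) (wA.const_mul d) mA fun t ht =>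
      mul_le_mul_of_nonneg_right (hmleft t ht)
        (hwpos t ⟨ht.1, by linarith [ht.2]⟩ (by linarith [ht.2])).le
  have hmM : 0 ≤ ∫ t in (-(x / 2))..(x / 2), m t * w t :=
    intervalIntegral.integral_nonneg (by linarith) hmid
  have hmR : d * ∫ t in (x / 2)..c, w t ≤ ∫ t in (x / 2)..c, m t * w t := by
    rw [← intervalIntegral.integral_const_mul]
    exact intervalIntegral.integral_mono_on (by linarith) ((wD.trans wE).const_mul d) mR
      fun t ht => mul_le_mul_of_nonneg_right (hmright t ht)
        (hwpos t ⟨by linarith [ht.1], ht.2⟩ (by linarith [ht.1])).le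
  refine ⟨by linarith, ?_⟩
  have key : (∫ t in (-c)..c, w t) ≤
      3 * ((∫ t in (-c)..(-(x / 2)), w t) + ∫ t in (x / 2)..c, w t) := by linarith
  have := mul_le_mul_of_nonneg_left key (by positivity : 0 ≤ d / 3)
  linarith

/-- Remark 4.23.1: with `β(t) = μ(t)|t|^{μ(t)} h(t)`, `ν(t) = μ(t)+2`, if `c ∈ (0,1)`,
`μ` and `h` are even, `h` is decreasing on `(0,c]`, and both `μ(t)` and `t^{μ(t)} h(t)`
are increasing on `(0,c]`, then for every `x > 0`, `r > 0` with `x² + r² < c²`,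
`|ω(x,r) - μ(0)| ≥ (μ(x/2) - μ(0))/3`, where `ω = k₁/k₂`,
`k₁(x,r) = ∫_{-c}^{c} μ(t) β(t) / ((t-x)²+r²)^{ν(t)/2} dt` and
`k₂(x,r) = ∫_{-c}^{c} β(t) / ((t-x)²+r²)^{ν(t)/2} dt`. -/
theorem stmt19 (c : ℝ) (hc : c ∈ Ioo (0 : ℝ) 1)
    (μ h : ℝ → ℝ)
    (hμcont : ContinuousOn μ (Icc (-c) c))
    (hhpos : ∀ t ∈ Icc (-c) c \ {0}, 0 < h t)
    (hβcont : ContinuousOn (fun t => μ t * |t| ^ μ t * h t) (Icc (-c) c \ {0}))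
    (hνcont : ContinuousOn (fun t => μ t + 2) (Icc (-c) c \ {0}))
    (hνbdd : ∃ M : ℝ, ∀ t ∈ Icc (-c) c \ {0}, μ t + 2 ≤ M)
    (hν1 : ∀ t ∈ Icc (-c) c \ {0}, 1 < μ t + 2)
    (hβpos : ∀ t ∈ Icc (-c) c \ {0}, 0 < μ t * |t| ^ μ t * h t)
    (hβint : IntegrableOn (fun t => μ t * |t| ^ μ t * h t) (Icc (-c) c))
    (hdiv : ∫⁻ t in Icc (-c) c,
        ENNReal.ofReal ((μ t * |t| ^ μ t * h t) * |t| ^ (-(μ t + 2))) = ⊤)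
    (hμeven : ∀ t : ℝ, μ (-t) = μ t)
    (hheven : ∀ t : ℝ, h (-t) = h t)
    (hhdec : StrictAntiOn h (Ioc 0 c))
    (hμinc : StrictMonoOn μ (Ioc 0 c))
    (hβinc : StrictMonoOn (fun t => t ^ μ t * h t) (Ioc 0 c))
    (x r : ℝ) (hx : 0 < x) (hr : 0 < r) (hxr : x ^ 2 + r ^ 2 < c ^ 2) :
    (μ (x / 2) - μ 0) / 3 ≤
      |(∫ t in Icc (-c) c,
            μ t * (μ t * |t| ^ μ t * h t) / (((t - x) ^ 2 + r ^ 2) ^ ((μ t + 2) / 2))) /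
          (∫ t in Icc (-c) c,
            (μ t * |t| ^ μ t * h t) / (((t - x) ^ 2 + r ^ 2) ^ ((μ t + 2) / 2))) -
        μ 0| := by
  have hc0 := hc.1
  have hxc : x < c := by nlinarith
  have hμpos : ∀ t ∈ Icc (-c) c, t ≠ 0 → 0 < μ t := by
    intro t ht h0
    have h1 := hβpos t ⟨ht, h0⟩
    have h2 := hhpos t ⟨ht, h0⟩
    have h3 : 0 < |t| ^ μ t := Real.rpow_pos_of_pos (abs_pos.2 h0) _
    rw [mul_assoc] at h1
    exact pos_of_mul_pos_left h1 (mul_pos h3 h2).le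
  have hμ0 : ∀ t ∈ Ioc 0 c, μ 0 ≤ μ t := by
    intro t ht
    have hcw : Tendsto μ (nhdsWithin 0 (Ioo 0 t)) (nhds (μ 0)) :=
      (hμcont 0 ⟨by linarith, hc0.le⟩).mono fun s hs =>
        ⟨by linarith [hs.1], by linarith [hs.2, ht.2]⟩
    have : (nhdsWithin (0 : ℝ) (Ioo 0 t)).NeBot := by
      rw [nhdsWithin_Ioo_eq_nhdsGT ht.1]
      infer_instance
    refine le_of_tendsto hcw ?_
    filter_upwards [self_mem_nhdsWithin] with s hs
    exact (hμinc ⟨hs.1, by linarith [hs.2, ht.2]⟩ ht hs.2).le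
  have hμ0' : ∀ t ∈ Icc (-c) c, μ 0 ≤ μ t := by
    intro t ht
    rcases lt_trichotomy t 0 with h0 | h0 | h0
    · rw [← hμeven t]
      exact hμ0 _ ⟨by linarith, by linarith [ht.1]⟩
    · rw [h0]
    · exact hμ0 _ ⟨h0, ht.2⟩
  have hbase : ∀ t : ℝ, 0 < (t - x) ^ 2 + r ^ 2 := fun t => by positivity
  set w : ℝ → ℝ := fun t =>
    (μ t * |t| ^ μ t * h t) / (((t - x) ^ 2 + r ^ 2) ^ ((μ t + 2) / 2)) with hwdef
  have hwpos : ∀ t ∈ Icc (-c) c, t ≠ 0 → 0 < w t := fun t ht h0 =>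
    div_pos (hβpos t ⟨ht, h0⟩) (Real.rpow_pos_of_pos (hbase t) _)
  have hwint : IntegrableOn w (Icc (-c) c) := by
    have hk : ContinuousOn (fun t => (((t - x) ^ 2 + r ^ 2) ^ ((μ t + 2) / 2))⁻¹)
        (Icc (-c) c) := by
      refine ContinuousOn.inv₀ (ContinuousOn.rpow (by fun_prop) (by fun_prop)
        fun t _ => Or.inl (hbase t).ne') fun t _ => (Real.rpow_pos_of_pos (hbase t) _).ne'
    simpa only [hwdef, div_eq_mul_inv] using hβint.mul_continuousOn hk isCompact_Icc
  have hμwint : IntegrableOn (fun t => μ t * w t) (Icc (-c) c) :=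
    hwint.continuousOn_mul hμcont isCompact_Icc
  have hmwint : IntegrableOn (fun t => (μ t - μ 0) * w t) (Icc (-c) c) :=
    hwint.continuousOn_mul (hμcont.sub continuousOn_const) isCompact_Icc
  have hle : -c ≤ c := by linarith
  have hxhalf : x / 2 ∈ Ioc 0 c := ⟨by linarith, by linarith⟩
  have hright : ∀ t ∈ Icc (x / 2) c, μ (x / 2) - μ 0 ≤ μ t - μ 0 := fun t ht =>
    sub_le_sub_right (hμinc.monotoneOn hxhalf ⟨by linarith [ht.1], ht.2⟩ ht.1) _
  have hneg : ∀ t ∈ Ioo 0 (x / 2), w (-t) ≤ w t := by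
    intro t ht
    simp only [hwdef, hμeven, hheven, abs_neg]
    have hb : (t - x) ^ 2 + r ^ 2 ≤ (-t - x) ^ 2 + r ^ 2 := by nlinarith [ht.1]
    have htc : t ∈ Icc (-c) c := ⟨by linarith [ht.1], by linarith [ht.2]⟩
    have hpos := hμpos t htc ht.1.ne'
    exact div_le_div_of_nonneg_left (hβpos t ⟨htc, ht.1.ne'⟩).le
      (Real.rpow_pos_of_pos (hbase t) _)
      (Real.rpow_le_rpow (hbase t).le hb (by linarith))
  have hrefl : ∀ t ∈ Ioo 0 (x / 2), w t ≤ w (x - t) := by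
    intro t ht
    have ht1 := ht.1
    have ht2 := ht.2
    have htI : t ∈ Ioc 0 c := ⟨ht1, by linarith⟩
    have hsI : x - t ∈ Ioc 0 c := ⟨by linarith, by linarith⟩
    have htc : t ∈ Icc (-c) c := ⟨by linarith, by linarith⟩
    have hsc : x - t ∈ Icc (-c) c := ⟨by linarith, by linarith⟩
    have hts : t < x - t := by linarith
    have hμts := (hμinc htI hsI hts).le
    have hμt := hμpos t htc ht1.ne'
    have hμs := hμpos (x - t) hsc hsI.1.ne'
    have hβts : μ t * |t| ^ μ t * h t ≤ μ (x - t) * |x - t| ^ μ (x - t) * h (x - t) := by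
      rw [abs_of_pos ht1, abs_of_pos hsI.1, mul_assoc, mul_assoc]
      exact mul_le_mul hμts (hβinc htI hsI hts).le
        (mul_pos (Real.rpow_pos_of_pos ht1 _) (hhpos t ⟨htc, ht1.ne'⟩)).le hμs.le
    have hb : (x - t - x) ^ 2 + r ^ 2 ≤ (t - x) ^ 2 + r ^ 2 := by nlinarith
    have hb1 : (x - t - x) ^ 2 + r ^ 2 ≤ 1 := by nlinarith [hc.2]
    refine div_le_div₀ (hβpos _ ⟨hsc, hsI.1.ne'⟩).le hβts
      (Real.rpow_pos_of_pos (hbase _) _) ?_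
    calc ((x - t - x) ^ 2 + r ^ 2) ^ ((μ (x - t) + 2) / 2)
        ≤ ((x - t - x) ^ 2 + r ^ 2) ^ ((μ t + 2) / 2) :=
          Real.rpow_le_rpow_of_exponent_ge (hbase _) hb1 (by linarith)
      _ ≤ ((t - x) ^ 2 + r ^ 2) ^ ((μ t + 2) / 2) :=
          Real.rpow_le_rpow (hbase _).le hb (by linarith)
  obtain ⟨hT, hmain⟩ := third_mul_integral_le_of_reflection (c := c) (x := x)
    (d := μ (x / 2) - μ 0) (w := w) (m := fun t => μ t - μ 0) hx hxc
    (sub_nonneg.2 (hμ0 _ hxhalf))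
    ((intervalIntegrable_iff_integrableOn_Icc_of_le hle).2 hwint)
    ((intervalIntegrable_iff_integrableOn_Icc_of_le hle).2 hmwint)
    hwpos
    (fun t ht => by
      have htc : t ∈ Icc (-c) c := ⟨by linarith [ht.1], by linarith [ht.2]⟩
      rcases eq_or_ne t 0 with rfl | h0
      · simp
      · exact mul_nonneg (sub_nonneg.2 (hμ0' t htc)) (hwpos t htc h0).le)
    (fun t ht => by
      simpa only [hμeven] using hright (-t) ⟨by linarith [ht.2], by linarith [ht.1]⟩)
    hright hneg hrefl
  simp only [intervalIntegral.integral_of_le hle, ← integral_Icc_eq_integral_Ioc] at hT hmain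
  have hsplit : ∫ t in Icc (-c) c, (μ t - μ 0) * w t =
      (∫ t in Icc (-c) c, μ t * w t) - μ 0 * ∫ t in Icc (-c) c, w t := by
    simp only [sub_mul]
    rw [integral_sub hμwint (hwint.const_mul _), integral_const_mul]
  simp only [mul_div_assoc (μ _) (μ _ * _ * _)]
  change _ ≤ |(∫ t in Icc (-c) c, μ t * w t) / (∫ t in Icc (-c) c, w t) - μ 0|
  refine le_trans ?_ (le_abs_self _)
  rw [le_sub_iff_add_le, le_div_iff₀ hT]
  linarith
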